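/- For every positive integer n, S_{2n}(n,n,n) = S₂(1). That is, a triple (x,y,z) ∈ ℝ³ arises as ((1/2n)Re Tr(P₁P₂), (1/2n)Re Tr(P₁P₃), (1/2n)Re Tr(P₂P₃)) for some rank-n orthogonal projections P₁,P₂,P₃ in M_{2n}(ℂ) if and only if it arises as ((1/2)Re Tr(Q₁Q₂), (1/2)Re Tr(Q₁Q₃), (1/2)Re Tr(Q₂Q₃)) for some rank-one orthogonal projections Q₁,Q₂,Q₃ in M₂(ℂ). -/

import Mathlib

open Matrix
open scoped Pointwise ComplexOrder

/-- `P` is an orthogonal projection matrix: `P = P† = P²`. -/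
def IsProjn {d : ℕ} (P : Matrix (Fin d) (Fin d) ℂ) : Prop :=
  P.IsHermitian ∧ P * P = P

/-- `corrSet d n₁ n₂ n₃` is the set `S_d(n₁,n₂,n₃) ⊆ ℝ³` of triples of normalized
traces of pairwise products of orthogonal projections of the prescribed ranks. -/
def corrSet (d n₁ n₂ n₃ : ℕ) : Set (ℝ × ℝ × ℝ) :=
  { x | ∃ P₁ P₂ P₃ : Matrix (Fin d) (Fin d) ℂ,
      IsProjn P₁ ∧ IsProjn P₂ ∧ IsProjn P₃ ∧
      P₁.rank = n₁ ∧ P₂.rank = n₂ ∧ P₃.rank = n₃ ∧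
      x = ((1 / (d : ℝ)) * ((P₁ * P₂).trace).re,
           (1 / (d : ℝ)) * ((P₁ * P₃).trace).re,
           (1 / (d : ℝ)) * ((P₂ * P₃).trace).re) }

open scoped Kronecker MatrixOrder

namespace IsProjn

variable {d : ℕ} {P : Matrix (Fin d) (Fin d) ℂ}

/-- The trace of an orthogonal projection is its rank. -/
theorem trace_eq_rank (hP : IsProjn P) : P.trace = P.rank := by
  have h : IsIdempotentElem P.toLin' := by
    rw [IsIdempotentElem, Module.End.mul_eq_comp, ← Matrix.toLin'_mul, hP.2]
  rw [← Matrix.trace_toLin'_eq, (LinearMap.IsIdempotentElem.isProj_range _ h).trace]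
  rfl

theorem rank_eq_of_trace_eq (hP : IsProjn P) {k : ℕ} (h : P.trace = k) : P.rank = k := by
  exact_mod_cast hP.trace_eq_rank.symm.trans h

end IsProjn

/-- The Gram matrix of finitely many complex matrices, for a nonnegative multiple of the real part
of the Hilbert-Schmidt inner product, is the Gram matrix of real vectors. -/
theorem exists_dotProduct_eq_mul_re_trace {ι m : Type*} [Fintype ι] [Fintype m]
    (A : ι → Matrix m m ℂ) {c : ℝ} (hc : 0 ≤ c) :
    ∃ v : ι → ι → ℝ, ∀ i j, v i ⬝ᵥ v j = c * ((A i)ᴴ * A j).trace.re := by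
  classical
  let W : Matrix ((m × m) ⊕ (m × m)) ι ℝ :=
    Matrix.of fun s i => s.elim (fun p => (A i p.1 p.2).re) (fun p => (A i p.1 p.2).im)
  have hW : ∀ i j, (Wᴴ * W) i j = ((A i)ᴴ * A j).trace.re := by
    intro i j
    rw [Matrix.mul_apply, Fintype.sum_sum_type, ← Finset.sum_add_distrib,
      Fintype.sum_prod_type_right]
    simp [W, Matrix.trace, Matrix.mul_apply]
  obtain ⟨B, hB⟩ := CStarAlgebra.nonneg_iff_eq_star_mul_self.mp
    ((posSemidef_conjTranspose_mul_self W).smul hc).nonneg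
  refine ⟨fun i k => B k i, fun i j => ?_⟩
  rw [← hW, ← smul_eq_mul, ← Matrix.smul_apply, hB]
  simp [Matrix.mul_apply, dotProduct, Matrix.star_eq_conjTranspose]

/-- The qubit operator `(1 + v · σ) / 2` with Bloch vector `v`. -/
noncomputable def blochMatrix (v : Fin 3 → ℝ) : Matrix (Fin 2) (Fin 2) ℂ :=
  !![(1 + v 2) / 2, (v 0 - v 1 * Complex.I) / 2; (v 0 + v 1 * Complex.I) / 2, (1 - v 2) / 2]

theorem trace_blochMatrix (v : Fin 3 → ℝ) : (blochMatrix v).trace = 1 := by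
  simp only [blochMatrix, Matrix.trace_fin_two_of]
  ring

theorem isProjn_blochMatrix {v : Fin 3 → ℝ} (hv : v ⬝ᵥ v = 1) : IsProjn (blochMatrix v) := by
  have hv' : (v 0 * v 0 + v 1 * v 1 + v 2 * v 2 : ℂ) = 1 := by
    rw [dotProduct, Fin.sum_univ_three] at hv
    exact_mod_cast hv
  constructor
  · ext i j
    fin_cases i <;> fin_cases j <;> simp [blochMatrix, Complex.ext_iff]
  · ext i j
    fin_cases i <;> fin_cases j <;> simp [blochMatrix, Matrix.mul_apply, Fin.sum_univ_two] <;>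
      first
      | ring1
      | linear_combination (1 / 4 : ℂ) * hv' - (v 1 * v 1 / 4 : ℂ) * Complex.I_sq

theorem re_trace_blochMatrix_mul (u v : Fin 3 → ℝ) :
    (blochMatrix u * blochMatrix v).trace.re = (1 + u ⬝ᵥ v) / 2 := by
  simp [blochMatrix, Matrix.trace_fin_two, dotProduct, Fin.sum_univ_three]
  ring

/-- The ampliation `P ⊗ 1ₙ`, as a matrix of size `d * n`. -/
noncomputable def ampliation {d : ℕ} (n : ℕ) (P : Matrix (Fin d) (Fin d) ℂ) :
    Matrix (Fin (d * n)) (Fin (d * n)) ℂ :=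
  Matrix.reindex finProdFinEquiv finProdFinEquiv (P ⊗ₖ (1 : Matrix (Fin n) (Fin n) ℂ))

section ampliation

variable {d : ℕ} (n : ℕ)

theorem ampliation_mul (P Q : Matrix (Fin d) (Fin d) ℂ) :
    ampliation n P * ampliation n Q = ampliation n (P * Q) := by
  simp [ampliation, Matrix.submatrix_mul_equiv, ← Matrix.mul_kronecker_mul]

theorem trace_ampliation (P : Matrix (Fin d) (Fin d) ℂ) :
    (ampliation n P).trace = n * P.trace := by
  have h : (ampliation n P).trace = (P ⊗ₖ (1 : Matrix (Fin n) (Fin n) ℂ)).trace :=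
    finProdFinEquiv.symm.sum_comp
      fun i => (P ⊗ₖ (1 : Matrix (Fin n) (Fin n) ℂ)) i i
  rw [h, Matrix.trace_kronecker, Matrix.trace_one, Fintype.card_fin, mul_comm]

theorem IsProjn.ampliation {P : Matrix (Fin d) (Fin d) ℂ} (hP : IsProjn P) :
    IsProjn (ampliation n P) := by
  constructor
  · have h : (P ⊗ₖ (1 : Matrix (Fin n) (Fin n) ℂ)).IsHermitian := by
      rw [Matrix.IsHermitian, Matrix.conjTranspose_kronecker, hP.1.eq, Matrix.conjTranspose_one]
    exact h.submatrix _
  · rw [ampliation_mul, hP.2]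

end ampliation

/-- For projections of rank `n` in dimension `2n`, passing to the reflections `2P - 1` recentres
the trace of a product. -/
theorem trace_reflection_mul {n : ℕ} {P Q : Matrix (Fin (2 * n)) (Fin (2 * n)) ℂ}
    (hP : IsProjn P) (hQ : IsProjn Q) (hPn : P.rank = n) (hQn : Q.rank = n) :
    ((2 * P - 1)ᴴ * (2 * Q - 1)).trace = 4 * (P * Q).trace - 2 * n := by
  have h : (2 * P - 1)ᴴ * (2 * Q - 1) =
      (4 : ℂ) • (P * Q) - (2 : ℂ) • P - (2 : ℂ) • Q + 1 := by
    have h2 : (2 * P - 1)ᴴ = 2 * P - 1 := by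
      simp [two_mul, hP.1.eq]
    rw [h2]
    simp only [two_mul, sub_mul, mul_sub, add_mul, mul_add, one_mul, mul_one]
    module
  rw [h]
  simp only [Matrix.trace_add, Matrix.trace_sub, Matrix.trace_smul, Matrix.trace_one,
    hP.trace_eq_rank, hQ.trace_eq_rank, hPn, hQn, Fintype.card_fin, smul_eq_mul]
  push_cast
  ring

theorem corrSet_two_n_subset {n : ℕ} (hn : 0 < n) :
    corrSet (2 * n) n n n ⊆ corrSet 2 1 1 1 := by
  rintro _ ⟨P₁, P₂, P₃, h₁, h₂, h₃, r₁, r₂, r₃, rfl⟩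
  let P : Fin 3 → Matrix (Fin (2 * n)) (Fin (2 * n)) ℂ := ![P₁, P₂, P₃]
  have hP : ∀ i, IsProjn (P i) := by simp [Fin.forall_fin_succ, P, h₁, h₂, h₃]
  have hr : ∀ i, (P i).rank = n := by simp [Fin.forall_fin_succ, P, r₁, r₂, r₃]
  have hn' : (n : ℝ) ≠ 0 := by exact_mod_cast hn.ne'
  obtain ⟨v, hv⟩ := exists_dotProduct_eq_mul_re_trace (fun i => 2 * P i - 1)
    (c := 1 / ((2 * n : ℕ) : ℝ)) (by positivity)
  have hdot : ∀ i j, v i ⬝ᵥ v j =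
      1 / ((2 * n : ℕ) : ℝ) * (4 * (P i * P j).trace.re - 2 * n) := by
    intro i j
    rw [hv, trace_reflection_mul (hP i) (hP j) (hr i) (hr j)]
    simp
  have hunit : ∀ i, v i ⬝ᵥ v i = 1 := by
    intro i
    rw [hdot, (hP i).2, (hP i).trace_eq_rank, hr, Complex.natCast_re]
    push_cast
    field_simp
    ring
  have hQ : ∀ i, IsProjn (blochMatrix (v i)) := fun i => isProjn_blochMatrix (hunit i)
  have hQr : ∀ i, (blochMatrix (v i)).rank = 1 := fun i =>
    (hQ i).rank_eq_of_trace_eq (by simp [trace_blochMatrix])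
  have htr : ∀ i j, 1 / ((2 * n : ℕ) : ℝ) * (P i * P j).trace.re =
      1 / ((2 : ℕ) : ℝ) * (blochMatrix (v i) * blochMatrix (v j)).trace.re := by
    intro i j
    rw [re_trace_blochMatrix_mul, hdot]
    push_cast
    field_simp
    ring
  exact ⟨_, _, _, hQ 0, hQ 1, hQ 2, hQr 0, hQr 1, hQr 2,
    Prod.ext (htr 0 1) (Prod.ext (htr 0 2) (htr 1 2))⟩

theorem subset_corrSet_mul {d n₁ n₂ n₃ n : ℕ} (hn : 0 < n) :
    corrSet d n₁ n₂ n₃ ⊆ corrSet (d * n) (n * n₁) (n * n₂) (n * n₃) := by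
  rintro _ ⟨P₁, P₂, P₃, h₁, h₂, h₃, rfl, rfl, rfl, rfl⟩
  have hn' : (n : ℝ) ≠ 0 := by exact_mod_cast hn.ne'
  have hr : ∀ {P : Matrix (Fin d) (Fin d) ℂ}, IsProjn P → (ampliation n P).rank = n * P.rank :=
    fun hP => (hP.ampliation n).rank_eq_of_trace_eq (by
      rw [trace_ampliation, hP.trace_eq_rank, Nat.cast_mul])
  have htr : ∀ P Q : Matrix (Fin d) (Fin d) ℂ, 1 / (d : ℝ) * (P * Q).trace.re =
      1 / ((d * n : ℕ) : ℝ) * (ampliation n P * ampliation n Q).trace.re := by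
    intro P Q
    rw [ampliation_mul, trace_ampliation, ← Complex.ofReal_natCast, Complex.re_ofReal_mul]
    push_cast
    field_simp
  exact ⟨_, _, _, h₁.ampliation n, h₂.ampliation n, h₃.ampliation n, hr h₁, hr h₂, hr h₃,
    Prod.ext (htr _ _) (Prod.ext (htr _ _) (htr _ _))⟩

/-- Part of Proposition 3.2: `S_{2n}(n,n,n) = S₂(1)` for every `n ≥ 1`. -/
theorem corrSet_two_n_eq (n : ℕ) (hn : 0 < n) :
    corrSet (2 * n) n n n = corrSet 2 1 1 1 := by
  refine (corrSet_two_n_subset hn).antisymm ?_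
  simpa only [mul_one] using subset_corrSet_mul (d := 2) (n₁ := 1) (n₂ := 1) (n₃ := 1) hn
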